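/- For all A, B ∈ Ã₂, the doubly contracted tensor product A : B is well defined, belongs to Ã₂, and satisfies ‖A : B‖_Ã₂ ≤ ‖A‖_Ã₂ ‖B‖_Ã₂. -/

import Mathlib

open scoped ComplexConjugate

noncomputable section

namespace PaperTensor

variable {I I₁ I₂ : Type*}

/-- The space `ℓ²(I)`. -/
abbrev L2 (I : Type*) := lp (fun _ : I => ℂ) 2

/-- The continuous linear map `T` represents the matrix `M` as an operator on `ℓ²(I)`,
i.e. `(T c) k = Σ_l M k l * c l` for every `c ∈ ℓ²(I)`. -/
def Represents (M : I → I → ℂ) (T : L2 I →L[ℂ] L2 I) : Prop :=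
  ∀ c : L2 I, ∀ k : I, HasSum (fun l : I => M k l * (c : ∀ _ : I, ℂ) l) ((T c : ∀ _ : I, ℂ) k)

/-- `M` defines a bounded operator on `ℓ²(I)`. -/
def Bounded2 (M : I → I → ℂ) : Prop := ∃ T : L2 I →L[ℂ] L2 I, Represents M T

/-- The operator norm `‖M‖_{B(ℓ²(I))}` of the matrix `M` (junk value `0` if `M` is unbounded). -/
noncomputable def opNorm2 (M : I → I → ℂ) : ℝ :=
  letI : Decidable (Bounded2 M) := Classical.propDecidable _
  if h : Bounded2 M then ‖h.choose‖ else 0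

/-- The matrix product of two infinite matrices. -/
noncomputable def matMul (A B : I → I → ℂ) : I → I → ℂ :=
  fun i j => ∑' m : I, A i m * B m j

/-- The conjugate transpose of a matrix. -/
def conjTranspose (A : I → I → ℂ) : I → I → ℂ := fun i j => conj (A j i)

/-- A solid Banach algebra of (infinite) matrices over the index set `I`. -/
structure SolidBanachAlgebra (I : Type*) where
  carrier : Set (I → I → ℂ)
  anorm : (I → I → ℂ) → ℝ
  zero_mem : (0 : I → I → ℂ) ∈ carrier
  add_mem : ∀ A B : I → I → ℂ, A ∈ carrier → B ∈ carrier → A + B ∈ carrier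
  smul_mem : ∀ (c : ℂ) (A : I → I → ℂ), A ∈ carrier → c • A ∈ carrier
  mul_mem : ∀ A B : I → I → ℂ, A ∈ carrier → B ∈ carrier → matMul A B ∈ carrier
  anorm_nonneg : ∀ A ∈ carrier, 0 ≤ anorm A
  anorm_zero : anorm 0 = 0
  anorm_eq_zero : ∀ A ∈ carrier, anorm A = 0 → A = 0
  anorm_smul : ∀ (c : ℂ), ∀ A ∈ carrier, anorm (c • A) = ‖c‖ * anorm A
  anorm_add : ∀ A ∈ carrier, ∀ B ∈ carrier, anorm (A + B) ≤ anorm A + anorm B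
  anorm_mul : ∀ A ∈ carrier, ∀ B ∈ carrier, anorm (matMul A B) ≤ anorm A * anorm B
  complete : ∀ f : ℕ → (I → I → ℂ), (∀ n, f n ∈ carrier) →
      (∀ ε > (0 : ℝ), ∃ N : ℕ, ∀ m ≥ N, ∀ n ≥ N, anorm (f m - f n) < ε) →
      ∃ A ∈ carrier, ∀ ε > (0 : ℝ), ∃ N : ℕ, ∀ n ≥ N, anorm (f n - A) < ε
  bounded : ∀ A ∈ carrier, Bounded2 A
  solid : ∀ A ∈ carrier, ∀ B : I → I → ℂ,
      (∀ i j, ‖B i j‖ ≤ ‖A i j‖) → B ∈ carrier ∧ anorm B ≤ anorm A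

/-- A matrix algebra is involutive if it is closed under conjugate transposition and the
norm is invariant under it. -/
def SolidBanachAlgebra.Involutive (𝒜 : SolidBanachAlgebra I) : Prop :=
  ∀ A ∈ 𝒜.carrier, conjTranspose A ∈ 𝒜.carrier ∧ 𝒜.anorm (conjTranspose A) = 𝒜.anorm A

/-- Rank-four tensors `(A_{i,k,l,j})` indexed by `I₁ × I₂² × I₁`. -/
abbrev Tensor (I₁ I₂ : Type*) := I₁ → I₂ → I₂ → I₁ → ℂ

/-- The restriction `A|_{{i} × I₂² × {j}}`, an `I₂ × I₂` matrix. -/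
def res1 (A : Tensor I₁ I₂) (i j : I₁) : I₂ → I₂ → ℂ := fun k l => A i k l j

/-- The restriction `A|_{I₁ × {(k,l)} × I₁}`, an `I₁ × I₁` matrix. -/
def res2 (A : Tensor I₁ I₂) (k l : I₂) : I₁ → I₁ → ℂ := fun i j => A i k l j

/-- Membership in `Ã₁`, for a set `S` of `I₁ × I₁` matrices playing the role of `𝒜₁`:
all restrictions `A|_{{i} × I₂² × {j}}` are bounded on `ℓ²(I₂)` and the matrix of their
operator norms belongs to `S`. -/
def MemT1 (S : Set (I₁ → I₁ → ℂ)) (A : Tensor I₁ I₂) : Prop :=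
  (∀ i j : I₁, Bounded2 (res1 A i j)) ∧
    (fun i j : I₁ => (opNorm2 (res1 A i j) : ℂ)) ∈ S

/-- Membership in `Ã₂`. -/
def MemT2 (S : Set (I₂ → I₂ → ℂ)) (A : Tensor I₁ I₂) : Prop :=
  (∀ k l : I₂, Bounded2 (res2 A k l)) ∧
    (fun k l : I₂ => (opNorm2 (res2 A k l) : ℂ)) ∈ S

/-- The norm `‖A‖_{Ã₁}` (meaningful on members of `Ã₁`). -/
noncomputable def normT1 (𝒜₁ : SolidBanachAlgebra I₁) (A : Tensor I₁ I₂) : ℝ :=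
  𝒜₁.anorm (fun i j : I₁ => (opNorm2 (res1 A i j) : ℂ))

/-- The norm `‖A‖_{Ã₂}` (meaningful on members of `Ã₂`). -/
noncomputable def normT2 (𝒜₂ : SolidBanachAlgebra I₂) (A : Tensor I₁ I₂) : ℝ :=
  𝒜₂.anorm (fun k l : I₂ => (opNorm2 (res2 A k l) : ℂ))

/-- Membership in `𝒜 = Ã₁ ∩ Ã₂`. -/
def MemA (𝒜₁ : SolidBanachAlgebra I₁) (𝒜₂ : SolidBanachAlgebra I₂) (A : Tensor I₁ I₂) : Prop :=
  MemT1 𝒜₁.carrier A ∧ MemT2 𝒜₂.carrier A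

/-- The norm `‖A‖_𝒜 = max {‖A‖_{Ã₁}, ‖A‖_{Ã₂}}`. -/
noncomputable def normA (𝒜₁ : SolidBanachAlgebra I₁) (𝒜₂ : SolidBanachAlgebra I₂)
    (A : Tensor I₁ I₂) : ℝ :=
  max (normT1 𝒜₁ A) (normT2 𝒜₂ A)

/-- The matrix over `I₁ × I₂` through which a rank-four tensor acts on `ℓ²(I₁ × I₂)`:
`(Ac)_{(i,k)} = Σ_{(m,n)} A_{i,k,n,m} c_{(m,n)}`. -/
def toMatrix (A : Tensor I₁ I₂) : (I₁ × I₂) → (I₁ × I₂) → ℂ :=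
  fun p q => A p.1 p.2 q.2 q.1

/-- The rank-four tensor of matrix entries of an operator `T` on `ℓ²(I₁ × I₂)`:
its `(i,k,l,j)` entry is the `((i,k),(j,l))` matrix entry of `T`. -/
noncomputable def entryTensor (T : L2 (I₁ × I₂) →L[ℂ] L2 (I₁ × I₂)) : Tensor I₁ I₂ :=
  letI : DecidableEq (I₁ × I₂) := Classical.decEq _
  fun i k l j => (T (lp.single 2 (j, l) (1 : ℂ)) : ∀ _ : I₁ × I₂, ℂ) (i, k)

/-- A set `S` of rank-four tensors is inverse-closed if, whenever `A ∈ S` acts as a boundedly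
invertible operator on `ℓ²(I₁ × I₂)`, the rank-four tensor of matrix entries of the inverse
operator also belongs to `S`. -/
def InverseClosed (S : Set (Tensor I₁ I₂)) : Prop :=
  ∀ A ∈ S, ∀ T Tinv : L2 (I₁ × I₂) →L[ℂ] L2 (I₁ × I₂),
    Represents (toMatrix A) T →
    T.comp Tinv = ContinuousLinearMap.id ℂ (L2 (I₁ × I₂)) →
    Tinv.comp T = ContinuousLinearMap.id ℂ (L2 (I₁ × I₂)) →
    entryTensor Tinv ∈ S

/-- The doubly contracted tensor product
`(A : B)_{i,k,l,j} = Σ_{n ∈ I₂} Σ_{m ∈ I₁} A_{i,k,n,m} B_{m,n,l,j}`. -/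
noncomputable def contract (A B : Tensor I₁ I₂) : Tensor I₁ I₂ :=
  fun i k l j => ∑' n : I₂, ∑' m : I₁, A i k n m * B m n l j

/-- Absolute convergence of all series defining the doubly contracted tensor product. -/
def ContractSummable (A B : Tensor I₁ I₂) : Prop :=
  ∀ (i : I₁) (k l : I₂) (j : I₁),
    Summable (fun nm : I₂ × I₁ => ‖A i k nm.1 nm.2 * B nm.2 nm.1 l j‖)

/-- The adjoint tensor `(A*)_{i,k,l,j} = conj (A_{j,l,k,i})`. -/
def adjT (A : Tensor I₁ I₂) : Tensor I₁ I₂ := fun i k l j => conj (A j l k i)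


theorem Represents.unique {M : I → I → ℂ} {S T : L2 I →L[ℂ] L2 I}
    (hS : Represents M S) (hT : Represents M T) : S = T := by
  ext c k
  exact (hS c k).unique (hT c k)

theorem Represents.opNorm2_eq {M : I → I → ℂ} {T : L2 I →L[ℂ] L2 I} (hT : Represents M T) :
    opNorm2 M = ‖T‖ := by
  have h : Bounded2 M := ⟨T, hT⟩
  rw [opNorm2, dif_pos h, h.choose_spec.unique hT]

open scoped Classical in
/-- The matrix entries of an operator represent it. -/
theorem represents_entries (T : L2 I →L[ℂ] L2 I) :
    Represents (fun i j => (T (lp.single 2 j (1 : ℂ)) : ∀ _ : I, ℂ) i) T := by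
  intro c k
  have h := (lp.hasSum_single (by simp : (2 : ENNReal) ≠ ⊤) c).mapL
    ((lp.evalCLM ℂ (fun _ : I => ℂ) 2 k).comp T)
  refine (congrArg (HasSum · _) (funext fun l => ?_)).mpr h
  have hl : lp.single 2 l (c l) = c l • (lp.single 2 l (1 : ℂ) : L2 I) := by
    rw [← lp.single_smul, smul_eq_mul, mul_one]
  rw [hl, map_smul, smul_eq_mul, mul_comm]
  rfl

open scoped Classical in
theorem Represents.apply_single {M : I → I → ℂ} {T : L2 I →L[ℂ] L2 I} (hT : Represents M T)
    (i j : I) : (T (lp.single 2 j (1 : ℂ)) : ∀ _ : I, ℂ) i = M i j := by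
  refine (hT _ i).unique ?_
  convert hasSum_single j ?_ using 1
  · simp
  · intro l hl
    simp [hl]

/-- The rows of a bounded matrix are absolutely summable against `ℓ²` vectors. -/
theorem Represents.summable_norm_and_tsum_le {M : I → I → ℂ} {T : L2 I →L[ℂ] L2 I}
    (hT : Represents M T) (x : L2 I) (k : I) :
    Summable (fun l => ‖M k l * x l‖) ∧ ∑' l, ‖M k l * x l‖ ≤ ‖T‖ * ‖x‖ := by
  choose u hu hux using fun l => RCLike.exists_norm_eq_mul_self (M k l * x l)
  let y : L2 I := ⟨fun l => u l * x l, (lp.memℓp x).norm.mono fun l => by simp [hu]⟩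
  have hyx : ‖y‖ ≤ ‖x‖ := lp.norm_mono (by simp) fun l => by simp [y, hu]
  have hs : HasSum (fun l => ((‖M k l * x l‖ : ℝ) : ℂ)) (T y k) := by
    convert hT y k using 2 with l
    exact (hux l).trans (mul_left_comm _ _ _)
  have hsum : Summable (fun l => ‖M k l * x l‖) := Complex.summable_ofReal.1 hs.summable
  refine ⟨hsum, ?_⟩
  have heq : ((∑' l, ‖M k l * x l‖ : ℝ) : ℂ) = T y k := by
    rw [Complex.ofReal_tsum]
    exact hs.tsum_eq
  calc ∑' l, ‖M k l * x l‖ ≤ ‖((∑' l, ‖M k l * x l‖ : ℝ) : ℂ)‖ := by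
        rw [Complex.norm_real]
        exact le_abs_self _
    _ = ‖T y k‖ := by rw [heq]
    _ ≤ ‖T y‖ := lp.norm_apply_le_norm (by simp) _ _
    _ ≤ ‖T‖ * ‖y‖ := T.le_opNorm y
    _ ≤ ‖T‖ * ‖x‖ := by gcongr

open scoped Classical in
/-- The series defining an entry of a product of bounded matrices converges. -/
theorem Bounded2.summable_mul {M N : I → I → ℂ} (hM : Bounded2 M) (hN : Bounded2 N) (k l : I) :
    Summable (fun n => M k n * N n l) := by
  obtain ⟨S, hS⟩ := hM
  obtain ⟨T, hT⟩ := hN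
  simpa only [hT.apply_single] using (hS (T (lp.single 2 l (1 : ℂ))) k).summable

open scoped Classical in
/-- If the norms of the products of the blocks are summable, then the block sum is represented by
a bounded operator whose norm is controlled by the sum of the norms. -/
theorem exists_represents_tsum {ι : Type*} {M N : ι → I → I → ℂ} {S T : ι → L2 I →L[ℂ] L2 I}
    (hS : ∀ n, Represents (M n) (S n)) (hT : ∀ n, Represents (N n) (T n))
    (hsum : Summable fun n => ‖S n‖ * ‖T n‖) :
    ∃ R : L2 I →L[ℂ] L2 I, Represents (fun i j => ∑' n, ∑' m, M n i m * N n m j) R ∧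
      ‖R‖ ≤ ∑' n, ‖S n‖ * ‖T n‖ := by
  have hle : ∀ n, ‖(S n).comp (T n)‖ ≤ ‖S n‖ * ‖T n‖ := fun n => (S n).opNorm_comp_le (T n)
  have hR := (hsum.of_norm_bounded hle).hasSum
  refine ⟨∑' n, (S n).comp (T n), ?_, tsum_of_norm_bounded hsum.hasSum hle⟩
  convert represents_entries (∑' n, (S n).comp (T n)) using 3 with i j
  let φ : (L2 I →L[ℂ] L2 I) →L[ℂ] ℂ := (lp.evalCLM ℂ (fun _ : I => ℂ) 2 i).comp
    (ContinuousLinearMap.apply ℂ (L2 I) (lp.single 2 j (1 : ℂ)))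
  refine Eq.trans (tsum_congr fun n => ?_) (hR.mapL φ).tsum_eq
  have h := (hS n (T n (lp.single 2 j (1 : ℂ))) i).tsum_eq
  simp only [(hT n).apply_single] at h
  exact h

open scoped Classical in
/-- Absolute convergence of the double series of a block product. -/
theorem summable_norm_block_mul {ι : Type*} {M N : ι → I → I → ℂ} {S T : ι → L2 I →L[ℂ] L2 I}
    (hS : ∀ n, Represents (M n) (S n)) (hT : ∀ n, Represents (N n) (T n))
    (hsum : Summable fun n => ‖S n‖ * ‖T n‖) (i j : I) :
    Summable fun nm : ι × I => ‖M nm.1 i nm.2 * N nm.1 nm.2 j‖ := by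
  have key : ∀ n, Summable (fun m => ‖M n i m * N n m j‖) ∧
      ∑' m, ‖M n i m * N n m j‖ ≤ ‖S n‖ * ‖T n‖ := by
    intro n
    have h := (hS n).summable_norm_and_tsum_le (T n (lp.single 2 j (1 : ℂ))) i
    simp only [(hT n).apply_single] at h
    refine ⟨h.1, h.2.trans ?_⟩
    gcongr
    refine ((T n).le_opNorm _).trans ?_
    rw [lp.norm_single (by simp), norm_one, mul_one]
  refine (summable_prod_of_nonneg fun _ => norm_nonneg _).2 ⟨fun n => (key n).1, ?_⟩
  exact hsum.of_nonneg_of_le (fun n => tsum_nonneg fun _ => norm_nonneg _) fun n => (key n).2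

/-- the doubly contracted product of two elements of `Ã₂` is well defined, lies in
`Ã₂`, and `‖A : B‖_Ã₂ ≤ ‖A‖_Ã₂ ‖B‖_Ã₂`. -/
theorem statement11 {I₁ I₂ : Type*} [Countable I₁] [Countable I₂]
    (𝒜₂ : SolidBanachAlgebra I₂)
    (A B : Tensor I₁ I₂) (hA : MemT2 𝒜₂.carrier A) (hB : MemT2 𝒜₂.carrier B) :
    ContractSummable A B ∧ MemT2 𝒜₂.carrier (contract A B) ∧
      normT2 𝒜₂ (contract A B) ≤ normT2 𝒜₂ A * normT2 𝒜₂ B := by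
  obtain ⟨hA, hA'⟩ := hA
  obtain ⟨hB, hB'⟩ := hB
  choose S hS using hA
  choose T hT using hB
  have hsumC : ∀ k l, Summable fun n =>
      ((opNorm2 (res2 A k n) : ℝ) : ℂ) * ((opNorm2 (res2 B n l) : ℝ) : ℂ) := fun k l =>
    (𝒜₂.bounded _ hA').summable_mul (𝒜₂.bounded _ hB') k l
  have hsum : ∀ k l, Summable fun n => ‖S k n‖ * ‖T n l‖ := by
    intro k l
    rw [← Complex.summable_ofReal]
    simpa only [(hS _ _).opNorm2_eq, (hT _ _).opNorm2_eq, Complex.ofReal_mul] using hsumC k l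
  choose R hR hRle using fun k l =>
    exists_represents_tsum (hS k) (fun n => hT n l) (hsum k l)
  replace hR : ∀ k l, Represents (res2 (contract A B) k l) (R k l) := hR
  have hdom : ∀ k l, ‖((opNorm2 (res2 (contract A B) k l) : ℝ) : ℂ)‖ ≤
      ‖matMul (fun k n => ((opNorm2 (res2 A k n) : ℝ) : ℂ))
        (fun n l => ((opNorm2 (res2 B n l) : ℝ) : ℂ)) k l‖ := by
    intro k l
    simp only [matMul, (hS _ _).opNorm2_eq, (hT _ _).opNorm2_eq, (hR _ _).opNorm2_eq,
      ← Complex.ofReal_mul, ← Complex.ofReal_tsum, Complex.norm_real, norm_norm]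
    exact (hRle k l).trans (le_abs_self _)
  have hsolid := 𝒜₂.solid _ (𝒜₂.mul_mem _ _ hA' hB')
    (fun k l => ((opNorm2 (res2 (contract A B) k l) : ℝ) : ℂ)) hdom
  exact ⟨fun i k l j => summable_norm_block_mul (hS k) (fun n => hT n l) (hsum k l) i j,
    ⟨fun k l => ⟨R k l, hR k l⟩, hsolid.1⟩, hsolid.2.trans (𝒜₂.anorm_mul _ hA' _ hB')⟩

end PaperTensor
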